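/- arXiv:2412.04271 — 3 statements merged into one kernel-verified Lean document; each statement's English description precedes it below -/
import Mathlib

section
/- Assume gcd(N, M) = 1 and let ñ ∈ S satisfy μ(ñ) = 0. Then for all k, l, m, m' ∈ ZMod M, the matrix element of the multiphoton Heisenberg–Weyl matrix on the orbit of ñ equals a single-photon Heisenberg–Weyl matrix element: Λ_{k,l}[σ^m ñ, σ^{m'} ñ] = L_{k, N·l}[m, m'] (σ iterated the representative of m, resp. m', times, and N·l computed in ZMod M). -/
open Matrix Complex BigOperators Finset

noncomputable section

set_option linter.unusedVariables false

/-- `ω = exp(2πi/M)`. -/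
def hwOmega (M : ℕ) : ℂ := Complex.exp (2 * Real.pi * Complex.I / M)

/-- Single-photon Heisenberg–Weyl matrix `L_{k,l} = X^k Z^l`,
with entries `L_{k,l}[m,m'] = ω^{l·m'}` if `m = m' + k` and `0` otherwise. -/
def HW (M : ℕ) [NeZero M] (k l : ZMod M) : Matrix (ZMod M) (ZMod M) ℂ :=
  Matrix.of fun m m' => if m = m' + k then hwOmega M ^ (l * m').val else 0

/-- Fock vectors: mode-occupation functions `ZMod M → ℕ` with total photon number `N`. -/
abbrev Fock (M N : ℕ) [NeZero M] := {n : ZMod M → ℕ // ∑ m, n m = N}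

instance (M N : ℕ) [NeZero M] : Fintype (Fock M N) :=
  Fintype.ofInjective
    (fun n (m : ZMod M) => (⟨n.1 m, Nat.lt_succ_of_le (le_of_le_of_eq
      (Finset.single_le_sum (fun i _ => Nat.zero_le _) (Finset.mem_univ m)) n.2)⟩ : Fin (N+1)))
    (fun a b h => Subtype.ext (funext fun m => congrArg Fin.val (congrFun h m)))

/-- The mode shift `σ`, `(σ n)(m) = n(m - 1)`. -/
def modeShift (M N : ℕ) [NeZero M] (n : Fock M N) : Fock M N :=
  ⟨fun m => n.1 (m - 1), by
    exact (Fintype.sum_equiv (Equiv.subRight (1 : ZMod M)) _ _ (fun m => rfl)).trans n.2⟩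

/-- The total mode index `μ(n) = ∑ m, m·n(m) ∈ ZMod M`. -/
def tmi (M N : ℕ) [NeZero M] (n : Fock M N) : ZMod M := ∑ m : ZMod M, m * (n.1 m : ZMod M)

/-- Multiphoton Heisenberg–Weyl matrix `Λ_{k,l}`, with entries `ω^{l·μ(n)}` at `(σ^k n, n)`
and `0` elsewhere. -/
def HWm (M N : ℕ) [NeZero M] (k l : ZMod M) : Matrix (Fock M N) (Fock M N) ℂ :=
  Matrix.of fun v n =>
    if v = (modeShift M N)^[k.val] n then hwOmega M ^ (l * tmi M N n).val else 0

theorem modeShift_iterate_apply (M N : ℕ) [NeZero M] (j : ℕ) (n : Fock M N) (x : ZMod M) :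
    ((modeShift M N)^[j] n).1 x = n.1 (x - j) := by
  induction j generalizing x with
  | zero => simp
  | succ j ih =>
    rw [Function.iterate_succ_apply']
    change ((modeShift M N)^[j] n).1 (x - 1) = _
    rw [ih]
    exact congrArg n.1 (by push_cast; ring)

theorem tmi_modeShift (M N : ℕ) [NeZero M] (n : Fock M N) :
    tmi M N (modeShift M N n) = tmi M N n + N := by
  have hsum : ∑ x : ZMod M, (n.1 x : ZMod M) = N := by exact_mod_cast congrArg Nat.cast n.2
  calc tmi M N (modeShift M N n)
      = ∑ x : ZMod M, (x + 1) * (n.1 x : ZMod M) :=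
        Fintype.sum_equiv (Equiv.subRight (1 : ZMod M)) _ _ fun x => by
          simp [modeShift]
    _ = tmi M N n + N := by
        simp only [add_mul, one_mul, Finset.sum_add_distrib, hsum, tmi]

theorem tmi_modeShift_iterate (M N : ℕ) [NeZero M] (j : ℕ) (n : Fock M N) :
    tmi M N ((modeShift M N)^[j] n) = tmi M N n + N * j := by
  induction j with
  | zero => simp
  | succ j ih =>
    rw [Function.iterate_succ_apply', tmi_modeShift, ih]
    push_cast
    ring

/-- Shifts by residues agree on a Fock vector iff the residues agree, when `N` and `M` are
coprime. -/
theorem modeShift_iterate_val_eq_iff (M N : ℕ) [NeZero M] (hgcd : Nat.gcd N M = 1)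
    (n : Fock M N) (k m m' : ZMod M) :
    (modeShift M N)^[m.val] n = (modeShift M N)^[k.val] ((modeShift M N)^[m'.val] n) ↔
      m = m' + k := by
  constructor
  · intro h
    have hμ := congrArg (tmi M N) h
    simp only [tmi_modeShift_iterate, ZMod.natCast_zmod_val, add_assoc, ← mul_add] at hμ
    exact ((ZMod.isUnit_iff_coprime N M).2 hgcd).mul_left_cancel (add_left_cancel hμ)
  · rintro rfl
    refine Subtype.ext (funext fun x => ?_)
    simp only [modeShift_iterate_apply, ZMod.natCast_zmod_val]
    exact congrArg n.1 (by ring)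

/-- on the orbit of a representative `ñ` with `μ(ñ) = 0`, the multiphoton HW
matrix element reduces to a single-photon one: `Λ_{k,l}[σ^m ñ, σ^{m'} ñ] = L_{k,N·l}[m,m']`. -/
theorem HWm_orbit_matrix_element (M N : ℕ) [NeZero M] (hN : 1 ≤ N)
    (hgcd : Nat.gcd N M = 1) (t : Fock M N) (ht : tmi M N t = 0) (k l m m' : ZMod M) :
    HWm M N k l ((modeShift M N)^[m.val] t) ((modeShift M N)^[m'.val] t) =
      HW M k ((N : ZMod M) * l) m m' := by
  simp only [HWm, HW, Matrix.of_apply, modeShift_iterate_val_eq_iff M N hgcd,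
    tmi_modeShift_iterate, ht, zero_add, ZMod.natCast_zmod_val]
  congr 3
  ring

end
end

section
/- (Permanent selection lemma.) Let k, l be natural numbers and assume N · gcd(2k, M) < M. For each j ∈ {0,…,M−1} define J_j : Matrix (ZMod M) (ZMod M) ℂ by J_j[m',m] = 𝟙[m' = m] + ω^{l·k + 2·j·k − 2·l·m'} · 𝟙[m = m' + 2k] (exponents computed in ZMod M, and ω^a meaning ω raised to the representative of a). Then for all ν, n ∈ S and all enumerations f, g of ν and n: (1/M) · Σ_{j=0}^{M−1} perm( (i,i') ↦ J_j[f i, g i'] ) equals ∏_m (n(m))! if ν = n and equals 0 otherwise. -/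
open Matrix Complex BigOperators Finset

noncomputable section

set_option linter.unusedVariables false

/-- `f : Fin N → ZMod M` enumerates the Fock vector `n`: each fiber `f⁻¹{m}` has `n(m)` elements. -/
def IsEnum (M N : ℕ) [NeZero M] (n : Fock M N) (f : Fin N → ZMod M) : Prop :=
  ∀ m : ZMod M, (Finset.univ.filter fun i => f i = m).card = n.1 m

theorem isPrimitiveRoot_hwOmega (M : ℕ) [NeZero M] : IsPrimitiveRoot (hwOmega M) M :=
  Complex.isPrimitiveRoot_exp M (NeZero.ne M)

theorem hwOmega_pow_val_natCast (M : ℕ) [NeZero M] (a : ℕ) :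
    hwOmega M ^ (a : ZMod M).val = hwOmega M ^ a := by
  rw [ZMod.val_natCast, ← pow_eq_pow_mod a (isPrimitiveRoot_hwOmega M).pow_eq_one]

theorem hwOmega_pow_val_add (M : ℕ) [NeZero M] (a b : ZMod M) :
    hwOmega M ^ (a + b).val = hwOmega M ^ a.val * hwOmega M ^ b.val := by
  rw [ZMod.val_add, ← pow_eq_pow_mod _ (isPrimitiveRoot_hwOmega M).pow_eq_one, pow_add]

/-- The phase of the off-diagonal entries of `J_j` is a `j`-independent phase times `(ω^{2k})^j`. -/
theorem hwOmega_pow_val_phase (M : ℕ) [NeZero M] (k l j : ℕ) (m : ZMod M) :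
    hwOmega M ^ (((l * k + 2 * j * k : ℕ) : ZMod M) - 2 * (l : ZMod M) * m).val =
      hwOmega M ^ ((l * k : ZMod M) - 2 * (l : ZMod M) * m).val *
        (hwOmega M ^ (2 * k)) ^ j := by
  have hsplit : ((l * k + 2 * j * k : ℕ) : ZMod M) - 2 * (l : ZMod M) * m =
      ((l * k : ZMod M) - 2 * (l : ZMod M) * m) + ((2 * k * j : ℕ) : ZMod M) := by
    push_cast; ring
  rw [hsplit, hwOmega_pow_val_add, hwOmega_pow_val_natCast, pow_mul]

theorem not_dvd_mul_of_mul_gcd_lt {M N a r : ℕ} (h : N * Nat.gcd a M < M) (hr : 0 < r)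
    (hrN : r ≤ N) : ¬ M ∣ a * r := by
  intro hdvd
  have hdvd' : M ∣ Nat.gcd a M * r := by
    rw [← Nat.gcd_mul_right]
    exact Nat.dvd_gcd hdvd (dvd_mul_right M r)
  have hM : 0 < M := by omega
  have hle := Nat.le_of_dvd (Nat.mul_pos (Nat.gcd_pos_of_pos_right a hM) hr) hdvd'
  have := Nat.mul_le_mul_right (Nat.gcd a M) hrN
  rw [mul_comm] at hle
  omega

theorem sum_range_pow_eq_zero {R : Type*} [CommRing R] [IsDomain R] {x : R} {M : ℕ}
    (hx : x ^ M = 1) (hx1 : x ≠ 1) : ∑ j ∈ Finset.range M, x ^ j = 0 := by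
  have hgeom := geom_sum_mul x M
  rw [hx, sub_self] at hgeom
  exact (mul_eq_zero.mp hgeom).resolve_right (sub_ne_zero.mpr hx1)

/-- Averaging `∏ (a + b x^j)` over `j` keeps only the term free of `x`, when no power `x^r`
with `1 ≤ r ≤ card ι` is trivial. -/
theorem sum_range_prod_add_mul_pow {ι R : Type*} [Fintype ι] [DecidableEq ι] [CommRing R]
    [IsDomain R] {x : R} {M : ℕ} (hx : x ^ M = 1)
    (hxr : ∀ r, 0 < r → r ≤ Fintype.card ι → x ^ r ≠ 1) (a b : ι → R) :
    ∑ j ∈ Finset.range M, ∏ i, (a i + b i * x ^ j) = M * ∏ i, a i := by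
  simp_rw [Finset.prod_add]
  rw [Finset.sum_comm, Finset.sum_eq_single Finset.univ]
  · simp
  · intro t _ ht
    have hpos : 0 < (Finset.univ \ t).card := by
      rw [Finset.card_pos, Finset.sdiff_nonempty]
      exact fun hsub => ht (Finset.univ_subset_iff.mp hsub)
    have hle : (Finset.univ \ t).card ≤ Fintype.card ι := Finset.card_le_univ _
    simp_rw [Finset.prod_mul_distrib, Finset.prod_const, ← pow_mul, mul_comm _ (Finset.card _),
      pow_mul, ← mul_assoc]
    rw [← Finset.mul_sum, sum_range_pow_eq_zero _ (hxr _ hpos hle), mul_zero]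
    rw [← pow_mul, mul_comm, pow_mul, hx, one_pow]
  · simp

theorem IsEnum.eq_of_comp_perm {M N : ℕ} [NeZero M] {ν n : Fock M N} {f g : Fin N → ZMod M}
    (hf : IsEnum M N ν f) (hg : IsEnum M N n g) (σ : Equiv.Perm (Fin N))
    (hσ : ∀ i, f (σ i) = g i) : ν = n := by
  refine Subtype.ext (funext fun m => ?_)
  rw [← hf m, ← hg m]
  exact (Finset.card_equiv σ fun i => by simp [hσ]).symm

theorem IsEnum.exists_perm {M N : ℕ} [NeZero M] {n : Fock M N} {f g : Fin N → ZMod M}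
    (hf : IsEnum M N n f) (hg : IsEnum M N n g) :
    ∃ σ : Equiv.Perm (Fin N), ∀ i, f (σ i) = g i := by
  have hcard (m : ZMod M) : Fintype.card {i // g i = m} = Fintype.card {i // f i = m} := by
    rw [Fintype.card_subtype, Fintype.card_subtype, hf m, hg m]
  exact ⟨Equiv.ofFiberEquiv fun m => Fintype.equivOfCardEq (hcard m),
    fun i => Equiv.ofFiberEquiv_map _ i⟩

theorem IsEnum.card_stabilizer {M N : ℕ} [NeZero M] {n : Fock M N} {g : Fin N → ZMod M}
    (hg : IsEnum M N n g) :
    (Finset.univ.filter fun σ : Equiv.Perm (Fin N) => ∀ i, g (σ i) = g i).card =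
      ∏ m, Nat.factorial (n.1 m) := by
  have hstab := DomMulAct.stabilizer_card g
  simp only [Fintype.card_subtype, hg _] at hstab
  rw [← hstab]
  simp only [funext_iff, Function.comp_apply]

theorem IsEnum.permanent_indicator {M N : ℕ} [NeZero M] {ν n : Fock M N} {f g : Fin N → ZMod M}
    (hf : IsEnum M N ν f) (hg : IsEnum M N n g) :
    Matrix.permanent (Matrix.of fun i i' : Fin N => if f i = g i' then (1 : ℂ) else 0) =
      if ν = n then ((∏ m, Nat.factorial (n.1 m) : ℕ) : ℂ) else 0 := by
  split_ifs with hνn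
  · subst hνn
    obtain ⟨τ, hτ⟩ := hf.exists_perm hg
    rw [← Matrix.permanent_permute_cols τ]
    simp [Matrix.permanent, Finset.prod_ite_zero, hτ, ← hg.card_stabilizer]
  · simp only [Matrix.permanent, Matrix.of_apply, Finset.prod_ite_zero]
    refine Finset.sum_eq_zero fun σ _ => if_neg fun hσ => hνn ?_
    exact hf.eq_of_comp_perm hg σ fun i => hσ i (Finset.mem_univ i)

/-- permanent selection lemma: averaging over `j` the permanents of the
matrices `J_j[m',m] = 𝟙[m' = m] + ω^{lk + 2jk − 2lm'} 𝟙[m = m' + 2k]` selects the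
diagonal `ν = n`, with value `∏_m n(m)!`. -/
theorem permanent_selection (M N : ℕ) [NeZero M] (hN : 1 ≤ N) (k l : ℕ)
    (h : N * Nat.gcd (2 * k) M < M) (ν n : Fock M N)
    (f g : Fin N → ZMod M) (hf : IsEnum M N ν f) (hg : IsEnum M N n g) :
    (1 / (M : ℂ)) * ∑ j ∈ Finset.range M,
        Matrix.permanent (Matrix.of fun i i' : Fin N =>
          (if f i = g i' then (1 : ℂ) else 0) +
            (if g i' = f i + ((2 * k : ℕ) : ZMod M) then
              hwOmega M ^ ((((l * k + 2 * j * k : ℕ) : ZMod M) -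
                2 * (l : ZMod M) * (f i)).val) else 0)) =
      if ν = n then ((∏ m, Nat.factorial (n.1 m) : ℕ) : ℂ) else 0 := by
  have hω := isPrimitiveRoot_hwOmega M
  have hroot : (hwOmega M ^ (2 * k)) ^ M = 1 := by
    rw [← pow_mul, mul_comm, pow_mul, hω.pow_eq_one, one_pow]
  have hne (r : ℕ) (hr : 0 < r) (hrN : r ≤ Fintype.card (Fin N)) :
      (hwOmega M ^ (2 * k)) ^ r ≠ 1 := by
    rw [← pow_mul, Ne, hω.pow_eq_one_iff_dvd]
    exact not_dvd_mul_of_mul_gcd_lt h hr (by simpa using hrN)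
  have hM : (M : ℂ) ≠ 0 := Nat.cast_ne_zero.mpr (NeZero.ne M)
  rw [← hf.permanent_indicator hg]
  simp only [Matrix.permanent, Matrix.of_apply, hwOmega_pow_val_phase, ← ite_zero_mul]
  rw [Finset.sum_comm]
  simp only [sum_range_prod_add_mul_pow hroot hne]
  rw [← Finset.mul_sum, ← mul_assoc, one_div, inv_mul_cancel₀ hM, one_mul]

end
end

section
/- (DQC1 implements the real part of a unitary, multiphoton version.) Let W, V : Matrix (ZMod M) (ZMod M) ℂ with W unitary (Wᴴ * W = 1), set U = Wᴴ * V * W, and let ρ : Matrix S S ℂ. Then Σ_{a,b ∈ S₂} ι(ρ)[a,b] · Γ₂( T(W,V)ᴴ * ζ₀ * T(W,V) )[b,a] = (1/2^N) · Σ_{ν,n ∈ S} ρ[ν,n] · Γ(U + Uᴴ)[n,ν]; that is, trace(ι(ρ) * Γ₂-matrix of the DQC1 observable) = (1/2^N) · trace(ρ * Γ-matrix of U + Uᴴ). -/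
open Matrix Complex BigOperators Finset

noncomputable section

set_option linter.unusedVariables false

/-- The balanced multimode beam splitter on the doubled modes. -/
def Hb (M : ℕ) [NeZero M] : Matrix (ZMod M ⊕ ZMod M) (ZMod M ⊕ ZMod M) ℂ :=
  ((1 : ℂ) / Real.sqrt 2) • Matrix.fromBlocks 1 1 1 (-1)

/-- The parity observable `ζ₀` on the doubled modes. -/
def zeta0 (M : ℕ) [NeZero M] : Matrix (ZMod M ⊕ ZMod M) (ZMod M ⊕ ZMod M) ℂ :=
  Matrix.fromBlocks 1 0 0 (-1)

/-- The DQC1 transfer matrix `T(W,V)`. -/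
def Tdqc1 (M : ℕ) [NeZero M] (W V : Matrix (ZMod M) (ZMod M) ℂ) :
    Matrix (ZMod M ⊕ ZMod M) (ZMod M ⊕ ZMod M) ℂ :=
  Matrix.fromBlocks Wᴴ 0 0 1 * Hb M * Matrix.fromBlocks 1 0 0 V * Hb M *
    Matrix.fromBlocks W 0 0 1

/-- Fock vectors on the doubled modes `ZMod M ⊕ ZMod M` with total photon number `N`. -/
abbrev Fock2 (M N : ℕ) [NeZero M] := {n : ZMod M ⊕ ZMod M → ℕ // ∑ m, n m = N}

instance (M N : ℕ) [NeZero M] : Fintype (Fock2 M N) :=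
  Fintype.ofInjective
    (fun n (m : ZMod M ⊕ ZMod M) => (⟨n.1 m, Nat.lt_succ_of_le (le_of_le_of_eq
      (Finset.single_le_sum (fun i _ => Nat.zero_le _) (Finset.mem_univ m)) n.2)⟩ : Fin (N+1)))
    (fun a b h => Subtype.ext (funext fun m => congrArg Fin.val (congrFun h m)))

/-- The embedding `ν ↦ ν⊕0` of single-wing Fock vectors into doubled-mode Fock vectors. -/
def femb (M N : ℕ) [NeZero M] (ν : Fock M N) : Fock2 M N :=
  ⟨Sum.elim ν.1 (fun _ => 0), by
    rw [Fintype.sum_sum_type]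
    simpa using ν.2⟩

/-- The embedding `ι` of an `S × S` matrix as an `S₂ × S₂` matrix supported on `ν⊕0` indices. -/
def iota (M N : ℕ) [NeZero M] (ρ : Matrix (Fock M N) (Fock M N) ℂ) :
    Matrix (Fock2 M N) (Fock2 M N) ℂ :=
  Matrix.of fun a b => ∑ ν : Fock M N, ∑ n : Fock M N,
    if a = femb M N ν ∧ b = femb M N n then ρ ν n else 0

/-- `f : Fin N → ZMod M ⊕ ZMod M` enumerates the doubled-mode Fock vector `n`. -/
def IsEnum2 (M N : ℕ) [NeZero M] (n : Fock2 M N) (f : Fin N → ZMod M ⊕ ZMod M) : Prop :=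
  ∀ m : ZMod M ⊕ ZMod M, (Finset.univ.filter fun i => f i = m).card = n.1 m

theorem exists_isEnum (M N : ℕ) [NeZero M] (n : Fock M N) : ∃ f, IsEnum M N n f := by
  have hcard : Fintype.card (Fin N) = Fintype.card (Σ m : ZMod M, Fin (n.1 m)) := by
    simp [n.2]
  let e := Fintype.equivOfCardEq hcard
  refine ⟨fun i => (e i).1, fun m => ?_⟩
  rw [← Fintype.card_subtype,
    Fintype.card_congr (e.subtypeEquiv (q := fun x => x.1 = m) fun _ => Iff.rfl),
    Fintype.card_congr (Equiv.sigmaSubtype m), Fintype.card_fin]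

theorem IsEnum.inl_femb {M N : ℕ} [NeZero M] {n : Fock M N} {f : Fin N → ZMod M}
    (h : IsEnum M N n f) : IsEnum2 M N (femb M N n) (fun i => Sum.inl (f i)) := by
  rintro (m | m)
  · simpa [femb] using h m
  · simp [femb]

theorem prod_factorial_femb {M N : ℕ} [NeZero M] (n : Fock M N) :
    ∏ m, Nat.factorial ((femb M N n).1 m) = ∏ m, Nat.factorial (n.1 m) := by
  simp [femb, Fintype.prod_sum_type]

theorem trace_iota_mul (M N : ℕ) [NeZero M] (ρ : Matrix (Fock M N) (Fock M N) ℂ)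
    (G₂ : Matrix (Fock2 M N) (Fock2 M N) ℂ) :
    Matrix.trace (iota M N ρ * G₂) =
      Matrix.trace (ρ * G₂.submatrix (femb M N) (femb M N)) := by
  have key (a b : Fock2 M N) : iota M N ρ a b * G₂ b a = ∑ ν : Fock M N, ∑ n : Fock M N,
      if a = femb M N ν then if b = femb M N n then ρ ν n * G₂ b a else 0 else 0 := by
    simp only [iota, Matrix.of_apply, Finset.sum_mul, ite_mul, zero_mul, ite_and]
  simp only [Matrix.trace, Matrix.diag, Matrix.mul_apply, key, Matrix.submatrix_apply]
  calc
    _ = ∑ a : Fock2 M N, ∑ ν : Fock M N, ∑ n : Fock M N, ∑ b : Fock2 M N,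
        if a = femb M N ν then if b = femb M N n then ρ ν n * G₂ b a else 0 else 0 := by
      refine Finset.sum_congr rfl fun a _ => ?_
      rw [Finset.sum_comm]
      exact Finset.sum_congr rfl fun ν _ => Finset.sum_comm
    _ = ∑ ν : Fock M N, ∑ n : Fock M N, ∑ a : Fock2 M N, ∑ b : Fock2 M N,
        if a = femb M N ν then if b = femb M N n then ρ ν n * G₂ b a else 0 else 0 := by
      rw [Finset.sum_comm]
      exact Finset.sum_congr rfl fun ν _ => Finset.sum_comm
    _ = _ := by simp

theorem Hb_mul_fromBlocks_mul_Hb (M : ℕ) [NeZero M] (V : Matrix (ZMod M) (ZMod M) ℂ) :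
    Hb M * Matrix.fromBlocks 1 0 0 V * Hb M =
      (1 / 2 : ℂ) • Matrix.fromBlocks (1 + V) (1 - V) (1 - V) (1 + V) := by
  have h : ((1 : ℂ) / Real.sqrt 2) * (1 / Real.sqrt 2) = 1 / 2 := by
    rw [div_mul_div_comm, ← Complex.ofReal_mul, Real.mul_self_sqrt (by norm_num)]
    norm_num
  simp only [Hb, Matrix.smul_mul, Matrix.mul_smul, smul_smul, h, Matrix.fromBlocks_multiply]
  simp [sub_eq_add_neg]

theorem dqc1_observable_toBlocks₁₁ (M : ℕ) [NeZero M] (W V : Matrix (ZMod M) (ZMod M) ℂ)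
    (hW : Wᴴ * W = 1) :
    ((Tdqc1 M W V)ᴴ * zeta0 M * Tdqc1 M W V).toBlocks₁₁ =
      (1 / 2 : ℂ) • ((Wᴴ * V * W) + (Wᴴ * V * W)ᴴ) := by
  have hT : Tdqc1 M W V = (1 / 2 : ℂ) • Matrix.fromBlocks
      (Wᴴ * (1 + V) * W) (Wᴴ * (1 - V)) ((1 - V) * W) (1 + V) := by
    have hassoc : Tdqc1 M W V = Matrix.fromBlocks Wᴴ 0 0 1 *
        (Hb M * Matrix.fromBlocks 1 0 0 V * Hb M) * Matrix.fromBlocks W 0 0 1 := by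
      simp only [Tdqc1, Matrix.mul_assoc]
    rw [hassoc, Hb_mul_fromBlocks_mul_Hb]
    simp [Matrix.fromBlocks_multiply]
  have hW' : W * Wᴴ = 1 := mul_eq_one_comm.mp hW
  have hcancel (X Y : Matrix (ZMod M) (ZMod M) ℂ) :
      (Wᴴ * (X * W)) * (Wᴴ * Y * W) = Wᴴ * (X * Y) * W := by
    calc _ = Wᴴ * X * (W * Wᴴ) * Y * W := by simp only [Matrix.mul_assoc]
      _ = _ := by simp only [hW', Matrix.mul_one, Matrix.mul_assoc]
  have hhalf : star (1 / 2 : ℂ) = 1 / 2 := by simp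
  rw [hT, zeta0, Matrix.conjTranspose_smul, hhalf, Matrix.fromBlocks_conjTranspose]
  simp only [Matrix.smul_mul, Matrix.mul_smul, smul_smul, Matrix.fromBlocks_multiply,
    Matrix.fromBlocks_smul, Matrix.toBlocks_fromBlocks₁₁, Matrix.mul_one, Matrix.mul_zero,
    add_zero, zero_add, Matrix.mul_neg, Matrix.conjTranspose_mul,
    Matrix.conjTranspose_conjTranspose, hcancel, Matrix.neg_mul]
  have hdiff : Wᴴ * ((1 + V)ᴴ * (1 + V)) * W + -(Wᴴ * (1 - V)ᴴ * ((1 - V) * W)) =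
      (2 : ℂ) • (Wᴴ * V * W + Wᴴ * (Vᴴ * W)) := by
    rw [Matrix.conjTranspose_add, Matrix.conjTranspose_sub, Matrix.conjTranspose_one, two_smul]
    noncomm_ring
  rw [← smul_neg, smul_smul, ← smul_add, hdiff, smul_smul]
  norm_num

/-- DQC1 implements the real part of a unitary, multiphoton version:
`tr(ι(ρ) · Γ₂(T(W,V)ᴴ ζ₀ T(W,V))) = (1/2^N) · tr(ρ · Γ(U + Uᴴ))` for `U = Wᴴ V W`.
The `Γ`- and `Γ₂`-matrices are characterized by their permanent formulas over all
enumerations. -/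
theorem DQC1_multiphoton_real_part (M N : ℕ) [NeZero M] (hN : 1 ≤ N)
    (W V : Matrix (ZMod M) (ZMod M) ℂ) (hW : Wᴴ * W = 1)
    (ρ : Matrix (Fock M N) (Fock M N) ℂ)
    (G : Matrix (Fock M N) (Fock M N) ℂ)
    (hG : ∀ (ν n : Fock M N) (f g : Fin N → ZMod M),
      IsEnum M N ν f → IsEnum M N n g →
      G ν n = Matrix.permanent (Matrix.of fun i j : Fin N =>
          ((Wᴴ * V * W) + (Wᴴ * V * W)ᴴ) (f i) (g j)) /
        (Real.sqrt (((∏ m, Nat.factorial (ν.1 m)) * ∏ m, Nat.factorial (n.1 m) : ℕ)) : ℂ))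
    (G₂ : Matrix (Fock2 M N) (Fock2 M N) ℂ)
    (hG₂ : ∀ (a b : Fock2 M N) (f g : Fin N → ZMod M ⊕ ZMod M),
      IsEnum2 M N a f → IsEnum2 M N b g →
      G₂ a b = Matrix.permanent (Matrix.of fun i j : Fin N =>
          ((Tdqc1 M W V)ᴴ * zeta0 M * Tdqc1 M W V) (f i) (g j)) /
        (Real.sqrt (((∏ m, Nat.factorial (a.1 m)) * ∏ m, Nat.factorial (b.1 m) : ℕ)) : ℂ)) :
    Matrix.trace (iota M N ρ * G₂) = (1 / 2 ^ N : ℂ) * Matrix.trace (ρ * G) := by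
  have hblock (m m' : ZMod M) :
      ((Tdqc1 M W V)ᴴ * zeta0 M * Tdqc1 M W V) (Sum.inl m) (Sum.inl m') =
        (1 / 2 : ℂ) * ((Wᴴ * V * W) + (Wᴴ * V * W)ᴴ) m m' :=
    congrFun (congrFun (dqc1_observable_toBlocks₁₁ M W V hW) m) m'
  have hsub : G₂.submatrix (femb M N) (femb M N) = (1 / 2 ^ N : ℂ) • G := by
    ext ν n
    obtain ⟨f, hf⟩ := exists_isEnum M N ν
    obtain ⟨g, hg⟩ := exists_isEnum M N n
    have hperm : Matrix.of (fun i j : Fin N => (1 / 2 : ℂ) *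
        ((Wᴴ * V * W) + (Wᴴ * V * W)ᴴ) (f i) (g j)) =
        (1 / 2 : ℂ) • Matrix.of fun i j : Fin N =>
          ((Wᴴ * V * W) + (Wᴴ * V * W)ᴴ) (f i) (g j) := rfl
    rw [Matrix.submatrix_apply, Matrix.smul_apply, hG ν n f g hf hg,
      hG₂ _ _ _ _ hf.inl_femb hg.inl_femb]
    simp only [hblock]
    rw [hperm, Matrix.permanent_smul, prod_factorial_femb, prod_factorial_femb,
      Fintype.card_fin, _root_.one_div_pow, smul_eq_mul, mul_div_assoc]
  rw [trace_iota_mul, hsub, Matrix.mul_smul, Matrix.trace_smul, smul_eq_mul]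

end
end
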